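/- arXiv:2304.13853 — 4 statements merged into one kernel-verified Lean document; each statement's English description precedes it below -/
import Mathlib

section
/- Let u ∈ 𝒰 and let d ∈ L¹(Ω). If ∫_Ω d(x)(v(x) − u(x)) dx ≥ 0 for every v ∈ 𝒰, then for almost every x ∈ Ω one has d(x)(t − u(x)) ≥ 0 for all t ∈ [α, β]. -/
open MeasureTheory Filter

/-- The set of admissible controls: measurable functions with values in `[α, β]`
a.e. on `Ω` (with respect to Lebesgue measure restricted to `Ω`). -/
def AdmissibleSet {N : ℕ} (Ω : Set (Fin N → ℝ)) (α β : ℝ) :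
    Set ((Fin N → ℝ) → ℝ) :=
  {v | Measurable v ∧ ∀ᵐ x ∂(volume.restrict Ω), v x ∈ Set.Icc α β}

theorem ae_nonneg_mul_sub_of_forall_integral_nonneg {N : ℕ} {Ω : Set (Fin N → ℝ)} {α β : ℝ}
    {u d : (Fin N → ℝ) → ℝ} (hu : u ∈ AdmissibleSet Ω α β)
    (hd : Integrable d (volume.restrict Ω))
    (hineq : ∀ v ∈ AdmissibleSet Ω α β,
      0 ≤ ∫ x, d x * (v x - u x) ∂(volume.restrict Ω))
    {t : ℝ} (ht : t ∈ Set.Icc α β) :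
    ∀ᵐ x ∂(volume.restrict Ω), 0 ≤ d x * (t - u x) := by
  classical
  obtain ⟨hum, hub⟩ := hu
  have hint : Integrable (fun x ↦ d x * (t - u x)) (volume.restrict Ω) := by
    refine hd.mul_bdd (c := β - α) (measurable_const.sub hum).aestronglyMeasurable ?_
    filter_upwards [hub] with x hx
    rw [Real.norm_eq_abs, abs_le]
    constructor <;> linarith [hx.1, hx.2, ht.1, ht.2]
  refine ae_nonneg_of_forall_setIntegral_nonneg hint fun s hs _ ↦ ?_
  have hv : s.piecewise (fun _ ↦ t) u ∈ AdmissibleSet Ω α β := by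
    refine ⟨measurable_const.piecewise hs hum, ?_⟩
    filter_upwards [hub] with x hx
    by_cases hxs : x ∈ s
    · simpa [hxs] using ht
    · simpa [hxs] using hx
  rw [← integral_indicator hs]
  refine (hineq _ hv).trans_eq (integral_congr_ae (.of_forall fun x ↦ ?_))
  by_cases hxs : x ∈ s <;> simp [hxs]

/-- If `∫_Ω d (v - u) ≥ 0` for every admissible `v`, then for a.e. `x ∈ Ω` one has
`d x * (t - u x) ≥ 0` for all `t ∈ [α, β]`. -/
theorem stmt_0 {N : ℕ} (hN : 1 ≤ N) (Ω : Set (Fin N → ℝ))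
    (hΩm : MeasurableSet Ω) (hΩb : Bornology.IsBounded Ω)
    (α β : ℝ) (hαβ : α < β)
    (u d : (Fin N → ℝ) → ℝ)
    (hu : u ∈ AdmissibleSet Ω α β)
    (hd : Integrable d (volume.restrict Ω))
    (hineq : ∀ v ∈ AdmissibleSet Ω α β,
      0 ≤ ∫ x, d x * (v x - u x) ∂(volume.restrict Ω)) :
    ∀ᵐ x ∂(volume.restrict Ω), ∀ t ∈ Set.Icc α β, 0 ≤ d x * (t - u x) := by
  filter_upwards [
    ae_nonneg_mul_sub_of_forall_integral_nonneg hu hd hineq (Set.left_mem_Icc.2 hαβ.le),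
    ae_nonneg_mul_sub_of_forall_integral_nonneg hu hd hineq (Set.right_mem_Icc.2 hαβ.le)]
    with x hxα hxβ t ht
  rcases le_total 0 (d x) with hdx | hdx
  · exact hxα.trans (mul_le_mul_of_nonneg_left (sub_le_sub_right ht.1 _) hdx)
  · exact hxβ.trans (mul_le_mul_of_nonpos_left (sub_le_sub_right ht.2 _) hdx)
end

section
/- Let u ∈ 𝒰 and let κ, C > 0. Let J : L^∞(Ω) → ℝ and A : L^∞(Ω) → ℝ be such that: (i) A(v − u) ≥ κ ‖v − u‖_{L¹(Ω)} for every v ∈ 𝒰; and (ii) for every v ∈ 𝒰 there exists R ∈ ℝ with |R| ≤ C ‖v − u‖²_{L²(Ω)} and J(v) = J(u) + A(v − u) + R. Then for every v ∈ 𝒰 with ‖v − u‖_{L^∞(Ω)} ≤ κ/(2C) one has J(v) ≥ J(u) + (κ/2) ‖v − u‖_{L¹(Ω)}; in particular, J(v) > J(u) whenever additionally v ≠ u in L^∞(Ω), so u is a strict L^∞-local minimum of J on 𝒰. -/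
open MeasureTheory Filter

/-- If `A` dominates the `L¹` norm with constant `κ` and `J` admits a first order
expansion around `u` with quadratic remainder, then `u` is a strict `L^∞`-local
minimum of `J` on the admissible set, with the quadratic growth
`J(v) ≥ J(u) + (κ/2) ‖v - u‖_{L¹}` for `‖v - u‖_{L^∞} ≤ κ/(2C)`. -/
theorem stmt_2 {N : ℕ} (hN : 1 ≤ N) (Ω : Set (Fin N → ℝ))
    (hΩm : MeasurableSet Ω) (hΩb : Bornology.IsBounded Ω)
    (α β : ℝ) (hαβ : α < β)
    (u : (Fin N → ℝ) → ℝ) (hu : u ∈ AdmissibleSet Ω α β)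
    (κ C : ℝ) (hκ : 0 < κ) (hC : 0 < C)
    (J A : ((Fin N → ℝ) → ℝ) → ℝ)
    (hA : ∀ v ∈ AdmissibleSet Ω α β,
      κ * ∫ x, |v x - u x| ∂(volume.restrict Ω) ≤ A (fun x => v x - u x))
    (hTaylor : ∀ v ∈ AdmissibleSet Ω α β, ∃ R : ℝ,
      |R| ≤ C * ∫ x, (v x - u x) ^ 2 ∂(volume.restrict Ω) ∧
      J v = J u + A (fun x => v x - u x) + R) :
    ∀ v ∈ AdmissibleSet Ω α β,
      (∀ᵐ x ∂(volume.restrict Ω), |v x - u x| ≤ κ / (2 * C)) →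
      (J u + κ / 2 * ∫ x, |v x - u x| ∂(volume.restrict Ω) ≤ J v ∧
        (¬ (v =ᵐ[volume.restrict Ω] u) → J u < J v)) := by
  intro v hv hbound
  have : Fact (volume Ω < ⊤) := ⟨hΩb.measure_lt_top⟩
  have hmeas : Measurable fun x => v x - u x := hv.1.sub hu.1
  have hint : Integrable (fun x => |v x - u x|) (volume.restrict Ω) :=
    (Integrable.of_bound hmeas.aestronglyMeasurable (κ / (2 * C)) hbound).abs
  have hsq : ∫ x, (v x - u x) ^ 2 ∂(volume.restrict Ω) ≤
      κ / (2 * C) * ∫ x, |v x - u x| ∂(volume.restrict Ω) := by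
    rw [← integral_const_mul]
    refine integral_mono_of_nonneg (.of_forall fun x => sq_nonneg _) (hint.const_mul _) ?_
    filter_upwards [hbound] with x hx
    rw [← sq_abs, sq]
    exact mul_le_mul_of_nonneg_right hx (abs_nonneg _)
  obtain ⟨R, hR, hJ⟩ := hTaylor v hv
  have hR' : |R| ≤ κ / 2 * ∫ x, |v x - u x| ∂(volume.restrict Ω) :=
    (hR.trans (mul_le_mul_of_nonneg_left hsq hC.le)).trans_eq (by field_simp)
  have hgrowth : J u + κ / 2 * ∫ x, |v x - u x| ∂(volume.restrict Ω) ≤ J v := by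
    linarith [hA v hv, neg_le_of_abs_le hR']
  refine ⟨hgrowth, fun hne => ?_⟩
  have hnonneg : 0 ≤ ∫ x, |v x - u x| ∂(volume.restrict Ω) :=
    integral_nonneg fun x => abs_nonneg _
  have hpos : 0 < ∫ x, |v x - u x| ∂(volume.restrict Ω) := by
    refine hnonneg.lt_of_ne fun h => hne ?_
    filter_upwards [(integral_eq_zero_iff_of_nonneg (fun x => abs_nonneg _) hint).1 h.symm]
      with x hx
    exact sub_eq_zero.1 (abs_eq_zero.1 hx)
  linarith [mul_pos (half_pos hκ) hpos]
end

section
/- Let h : Ω × ℝ → ℝ and M > 0 be such that: x ↦ h(x, t) is Lebesgue measurable for every t ∈ [α, β]; t ↦ h(x, t) is continuous on [α, β] for a.e. x ∈ Ω; and |h(x, t)| ≤ M for a.e. x ∈ Ω and all t ∈ [α, β]. Let u ∈ 𝒰 be such that ∫_Ω h(x, u(x)) dx ≤ ∫_Ω h(x, v(x)) dx for every v ∈ 𝒰. Then for a.e. x ∈ Ω, h(x, u(x)) = min_{t ∈ [α, β]} h(x, t). -/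
open MeasureTheory Filter

/-- A Carathéodory function composed with a measurable selection of its parameter is a.e. strongly
measurable. -/
theorem aestronglyMeasurable_comp_of_continuousOn {X : Type*} [MeasurableSpace X] {μ : Measure X}
    {a b : ℝ} (hab : a ≤ b) {h : X → ℝ → ℝ}
    (h_meas : ∀ t ∈ Set.Icc a b, Measurable fun x => h x t)
    (h_cont : ∀ᵐ x ∂μ, ContinuousOn (h x) (Set.Icc a b))
    {v : X → ℝ} (hv : Measurable v) (hv_mem : ∀ᵐ x ∂μ, v x ∈ Set.Icc a b) :
    AEStronglyMeasurable (fun x => h x (v x)) μ := by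
  classical
  obtain ⟨s, hs_sub, hs, hs_null⟩ := exists_measurable_superset_of_null (ae_iff.1 h_cont)
  let H : Set.Icc a b → X → ℝ := fun t => s.piecewise 0 fun x => h x t
  have hH_cont : ∀ x, Continuous fun t => H t x := by
    intro x
    by_cases hx : x ∈ s
    · simpa [H, hx] using continuous_const
    · have hc : ContinuousOn (h x) (Set.Icc a b) := by
        by_contra hc
        exact hx (hs_sub hc)
      simpa [H, hx, Set.domRestrict_def] using continuousOn_iff_continuous_domRestrict.1 hc
  have hH_meas : ∀ t, StronglyMeasurable (H t) := fun t =>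
    (Measurable.piecewise hs measurable_const (h_meas t t.2)).stronglyMeasurable
  have hH := stronglyMeasurable_uncurry_of_continuous_of_stronglyMeasurable hH_cont hH_meas
  have hproj : Measurable fun x => (Set.projIcc a b hab (v x), x) :=
    (continuous_projIcc.measurable.comp hv).prodMk measurable_id
  refine ⟨_, hH.comp_measurable hproj, ?_⟩
  filter_upwards [hv_mem, measure_eq_zero_iff_ae_notMem.1 hs_null] with x hx hxs
  simp [H, Function.uncurry, hxs, Set.projIcc_of_mem hab hx]

/-- Pointwise Pontryagin principle: if `u` minimizes `v ↦ ∫_Ω h(x, v(x)) dx` over the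
admissible set, then for a.e. `x ∈ Ω`, `h(x, u(x)) = min_{t ∈ [α,β]} h(x, t)`. -/
theorem stmt_4 {N : ℕ} (hN : 1 ≤ N) (Ω : Set (Fin N → ℝ))
    (hΩm : MeasurableSet Ω) (hΩb : Bornology.IsBounded Ω)
    (α β : ℝ) (hαβ : α < β)
    (h : (Fin N → ℝ) → ℝ → ℝ) (M : ℝ) (hM : 0 < M)
    (h_meas : ∀ t ∈ Set.Icc α β, Measurable fun x => h x t)
    (h_cont : ∀ᵐ x ∂(volume.restrict Ω), ContinuousOn (h x) (Set.Icc α β))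
    (h_bdd : ∀ᵐ x ∂(volume.restrict Ω), ∀ t ∈ Set.Icc α β, |h x t| ≤ M)
    (u : (Fin N → ℝ) → ℝ) (hu : u ∈ AdmissibleSet Ω α β)
    (hopt : ∀ v ∈ AdmissibleSet Ω α β,
      ∫ x, h x (u x) ∂(volume.restrict Ω) ≤ ∫ x, h x (v x) ∂(volume.restrict Ω)) :
    ∀ᵐ x ∂(volume.restrict Ω), ∀ t ∈ Set.Icc α β, h x (u x) ≤ h x t := by
  classical
  set μ := volume.restrict Ω
  have : IsFiniteMeasure μ := ⟨by simpa [μ] using hΩb.measure_lt_top⟩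
  have h_int : ∀ v ∈ AdmissibleSet Ω α β, Integrable (fun x => h x (v x)) μ := by
    intro v hv
    refine Integrable.of_bound
      (aestronglyMeasurable_comp_of_continuousOn hαβ.le h_meas h_cont hv.1 hv.2) M ?_
    filter_upwards [h_bdd, hv.2] with x hx hvx using hx _ hvx
  have key : ∀ t ∈ Set.Icc α β, ∀ᵐ x ∂μ, h x (u x) ≤ h x t := by
    intro t ht
    obtain ⟨g, hg, hgu⟩ := (h_int u hu).aestronglyMeasurable
    let A : Set (Fin N → ℝ) := {x | h x t < g x}
    have hA : MeasurableSet A := measurableSet_lt (h_meas t ht) hg.measurable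
    let v : (Fin N → ℝ) → ℝ := A.piecewise (fun _ => t) u
    have hv : v ∈ AdmissibleSet Ω α β := by
      refine ⟨Measurable.piecewise hA measurable_const hu.1, ?_⟩
      filter_upwards [hu.2] with x hx
      by_cases hxA : x ∈ A <;> simp only [v, hxA, Set.piecewise, if_true, if_false, ht, hx]
    have h_le : ∀ᵐ x ∂μ, h x (v x) ≤ h x (u x) := by
      filter_upwards [hgu] with x hx
      by_cases hxA : x ∈ A
      · simpa [v, hxA, hx] using le_of_lt hxA
      · simp [v, hxA]
    have h_eq := (integral_eq_iff_of_ae_le (h_int v hv) (h_int u hu) h_le).1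
      (le_antisymm (integral_mono_ae (h_int v hv) (h_int u hu) h_le) (hopt v hv))
    filter_upwards [h_eq, hgu] with x hx hgx
    by_cases hxA : x ∈ A
    · exact (by simpa [v, hxA] using hx.symm : h x (u x) = h x t).le
    · exact hgx.trans_le (not_lt.1 hxA)
  have : Nonempty (Set.Icc α β) := ⟨⟨α, Set.left_mem_Icc.2 hαβ.le⟩⟩
  have key' : ∀ᵐ x ∂μ, ∀ n,
      h x (u x) ≤ h x (TopologicalSpace.denseSeq (Set.Icc α β) n) :=
    ae_all_iff.2 fun n => key _ (TopologicalSpace.denseSeq (Set.Icc α β) n).2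
  filter_upwards [key', h_cont] with x hx hc t ht
  have hclosed : IsClosed {s : Set.Icc α β | h x (u x) ≤ h x s} :=
    isClosed_le continuous_const (continuousOn_iff_continuous_domRestrict.1 hc)
  exact (TopologicalSpace.denseRange_denseSeq (Set.Icc α β)).induction_on
    (p := fun s => h x (u x) ≤ h x s) ⟨t, ht⟩ hclosed hx
end

section
/- Let ℓ, f : Ω × [α, β] → ℝ be such that x ↦ ℓ(x, t) and x ↦ f(x, t) are Lebesgue measurable for every t ∈ [α, β], and t ↦ ℓ(x, t) and t ↦ f(x, t) are continuous on [α, β] for a.e. x ∈ Ω. Let L̄, F̄ : Ω → ℝ be Lebesgue-measurable functions such that for a.e. x ∈ Ω there exists t ∈ [α, β] with L̄(x) ≥ ℓ(x, t) and F̄(x) = f(x, t). Then there exists a Lebesgue-measurable function ū : Ω → [α, β] such that for a.e. x ∈ Ω, L̄(x) ≥ ℓ(x, ū(x)) and F̄(x) = f(x, ū(x)). -/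
open MeasureTheory Filter

/-- On a compact set, a nonnegative continuous function has a zero iff it takes arbitrarily small
values on a dense subset. -/
theorem IsCompact.exists_eq_zero_iff_forall_exists_lt {T : Type*} [TopologicalSpace T]
    {K D : Set T} (hK : IsCompact K) (hDK : D ⊆ K) (hKD : K ⊆ closure D) {h : T → ℝ}
    (hc : ContinuousOn h K) (hnn : ∀ t ∈ K, 0 ≤ h t) :
    (∃ t ∈ K, h t = 0) ↔ ∀ n : ℕ, ∃ t ∈ D, h t < 1 / ((n : ℝ) + 1) := by
  constructor
  · rintro ⟨t, htK, ht⟩ n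
    have hpos : h t < 1 / ((n : ℝ) + 1) := by rw [ht]; positivity
    have hev : ∀ᶠ s in nhdsWithin t D, h s < 1 / ((n : ℝ) + 1) :=
      ((hc t htK).mono hDK).eventually_lt_const hpos
    have : (nhdsWithin t D).NeBot := mem_closure_iff_nhdsWithin_neBot.1 (hKD htK)
    obtain ⟨s, hs, hsD⟩ := (hev.and self_mem_nhdsWithin).exists
    exact ⟨s, hsD, hs⟩
  · intro hD
    obtain ⟨t₀, ht₀, -⟩ := hD 0
    obtain ⟨t, htK, hmin⟩ := hK.exists_isMinOn ⟨t₀, hDK ht₀⟩ hc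
    refine ⟨t, htK, le_antisymm (le_of_forall_pos_le_add fun ε hε => ?_) (hnn t htK)⟩
    obtain ⟨n, hn⟩ := exists_nat_one_div_lt hε
    obtain ⟨s, hsD, hs⟩ := hD n
    have := isMinOn_iff.1 hmin s (hDK hsD)
    linarith

/-- The first zero in a compact set `K ⊆ ℝ` of a nonnegative Carathéodory function is a measurable
selection of its zeros. -/
theorem exists_measurable_selection_eq_zero {X : Type*} [MeasurableSpace X] {K : Set ℝ}
    (hK : IsCompact K) (hKne : K.Nonempty) {S : Set X} (hS : MeasurableSet S) {g : X → ℝ → ℝ}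
    (hg : ∀ t ∈ K, Measurable fun x => g x t) (hc : ∀ x ∈ S, ContinuousOn (g x) K)
    (hnn : ∀ x, ∀ t ∈ K, 0 ≤ g x t) (hex : ∀ x ∈ S, ∃ t ∈ K, g x t = 0) :
    ∃ u : X → ℝ, Measurable u ∧ (∀ x, u x ∈ K) ∧ ∀ x ∈ S, g x (u x) = 0 := by
  classical
  have hfirst : ∀ x ∈ S, ∃ t ∈ K, g x t = 0 ∧ ∀ s ∈ K, g x s = 0 → t ≤ s := by
    intro x hx
    have hZ : IsCompact (K ∩ g x ⁻¹' {0}) :=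
      hK.of_isClosed_subset ((hc x hx).preimage_isClosed_of_isClosed hK.isClosed isClosed_singleton)
        Set.inter_subset_left
    obtain ⟨t, ⟨htK, ht⟩, hle⟩ := hZ.exists_isLeast (hex x hx)
    exact ⟨t, htK, ht, fun s hs hs0 => hle ⟨hs, hs0⟩⟩
  choose! v hvK hv0 hvle using hfirst
  obtain ⟨a, ha⟩ := hKne
  have hvm : ∀ c, MeasurableSet (S ∩ {x | v x ≤ c}) := by
    intro c
    have hKc : IsCompact (K ∩ Set.Iic c) := hK.inter_right isClosed_Iic
    obtain ⟨D, hDK, hD, hKD⟩ := (TopologicalSpace.IsSeparable.of_separableSpace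
      (K ∩ Set.Iic c)).exists_countable_dense_subset
    have heq : S ∩ {x | v x ≤ c} = S ∩ ⋂ n : ℕ, ⋃ t ∈ D, {x | g x t < 1 / ((n : ℝ) + 1)} := by
      ext x
      simp only [Set.mem_inter_iff, Set.mem_ofPred_eq, Set.mem_iInter, Set.mem_iUnion, exists_prop]
      refine and_congr_right fun hx => ?_
      rw [← hKc.exists_eq_zero_iff_forall_exists_lt hDK hKD
        ((hc x hx).mono Set.inter_subset_left) fun t ht => hnn x t ht.1]
      exact ⟨fun h => ⟨v x, ⟨hvK x hx, h⟩, hv0 x hx⟩,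
        fun ⟨t, ht, ht0⟩ => (hvle x hx t ht.1 ht0).trans ht.2⟩
    rw [heq]
    exact hS.inter (.iInter fun n => .biUnion hD fun t ht =>
      measurableSet_lt (hg t (hDK ht).1) measurable_const)
  refine ⟨S.piecewise v fun _ => a, measurable_of_Iic fun c => ?_, fun x => ?_, fun x hx => ?_⟩
  · rw [Set.piecewise_preimage, Set.ite]
    refine .union ?_ ((measurable_const measurableSet_Iic).diff hS)
    rw [Set.inter_comm]
    exact hvm c
  · by_cases hx : x ∈ S
    · simpa [hx] using hvK x hx
    · simpa [hx] using ha
  · simpa [hx] using hv0 x hx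

/-- Measurable selection: if for a.e. `x ∈ Ω` there is `t ∈ [α, β]` with
`L̄(x) ≥ ℓ(x, t)` and `F̄(x) = f(x, t)`, then such a `t` can be chosen as a
measurable function `ū` of `x` with values in `[α, β]`. -/
theorem stmt_6 {N : ℕ} (hN : 1 ≤ N) (Ω : Set (Fin N → ℝ))
    (hΩm : MeasurableSet Ω) (hΩb : Bornology.IsBounded Ω)
    (α β : ℝ) (hαβ : α < β)
    (ℓ f : (Fin N → ℝ) → ℝ → ℝ)
    (hℓ_meas : ∀ t ∈ Set.Icc α β, Measurable fun x => ℓ x t)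
    (hf_meas : ∀ t ∈ Set.Icc α β, Measurable fun x => f x t)
    (hℓ_cont : ∀ᵐ x ∂(volume.restrict Ω), ContinuousOn (ℓ x) (Set.Icc α β))
    (hf_cont : ∀ᵐ x ∂(volume.restrict Ω), ContinuousOn (f x) (Set.Icc α β))
    (Lbar Fbar : (Fin N → ℝ) → ℝ)
    (hLbar : Measurable Lbar) (hFbar : Measurable Fbar)
    (hae : ∀ᵐ x ∂(volume.restrict Ω),
      ∃ t ∈ Set.Icc α β, ℓ x t ≤ Lbar x ∧ Fbar x = f x t) :
    ∃ ubar : (Fin N → ℝ) → ℝ, Measurable ubar ∧ (∀ x, ubar x ∈ Set.Icc α β) ∧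
      ∀ᵐ x ∂(volume.restrict Ω), ℓ x (ubar x) ≤ Lbar x ∧ Fbar x = f x (ubar x) := by
  have hgood := hℓ_cont.and (hf_cont.and hae)
  obtain ⟨S, hSae, hS, hSgood⟩ := hgood.exists_measurable_mem
  have hzero : ∀ x t, max (ℓ x t - Lbar x) 0 + |f x t - Fbar x| = 0 ↔
      ℓ x t ≤ Lbar x ∧ Fbar x = f x t := by
    intro x t
    rw [add_eq_zero_iff_of_nonneg (le_max_right _ _) (abs_nonneg _), max_eq_right_iff,
      abs_eq_zero, sub_nonpos, sub_eq_zero, eq_comm (a := f x t)]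
  obtain ⟨u, hu, huK, hu0⟩ := exists_measurable_selection_eq_zero (isCompact_Icc (a := α) (b := β))
    (Set.nonempty_Icc.2 hαβ.le) hS (g := fun x t => max (ℓ x t - Lbar x) 0 + |f x t - Fbar x|)
    (fun t ht => (((hℓ_meas t ht).sub hLbar).max measurable_const).add
      ((hf_meas t ht).sub hFbar).abs)
    (fun x hx => (((hSgood x hx).1.sub continuousOn_const).sup continuousOn_const).add
      ((hSgood x hx).2.1.sub continuousOn_const).abs)
    (fun x t _ => by positivity)
    (fun x hx => by simpa only [hzero] using (hSgood x hx).2.2)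
  refine ⟨u, hu, huK, ?_⟩
  filter_upwards [hSae] with x hx
  exact (hzero x (u x)).1 (hu0 x hx)
end
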